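/- Let n ∈ ℕ and q, t1, t2, t3, u ∈ ℂ with q ≠ 0, t1 ≠ 0, t3 ≠ 0, u ≠ 0. Set t4 = q^{1−n}/t3 (so that t1t2t3t4·q^{n−1} = t1t2). Assume (q;q)_k ≠ 0, (t1t2;q)_k ≠ 0, (t1t3;q)_k ≠ 0, and (q^{1−n}t1/t3;q)_k ≠ 0 for all k ≤ n, and (t3/t1;q)_n ≠ 0. Then p_n(u; t1, t2, t3, q^{1−n}/t3 | q) = (t3 u;q)_n · (t3/u;q)_n · [(t1t2;q)_n (q^{1−n}t1/t3;q)_n] / [t1^n (t3/t1;q)_n]. In particular all zeros of this Askey–Wilson polynomial in the variable x = (u+1/u)/2 are given explicitly by the vanishing of the factor (t3 u;q)_n (t3/u;q)_n. -/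

import Mathlib

open Finset

/-- q-shifted factorial `(a;q)_k = ∏_{j=0}^{k-1} (1 - a q^j)`. -/
noncomputable def qpoch (a q : ℂ) (k : ℕ) : ℂ := ∏ i ∈ Finset.range k, (1 - a * q ^ i)

/-- The Askey–Wilson polynomial `p_n(u; t1,t2,t3,t4 | q)` in the variable `u`
(`u` plays the role of `e^{iθ}`, so `x = (u + 1/u)/2 = cos θ`). -/
noncomputable def askeyWilson (q : ℂ) (n : ℕ) (u t1 t2 t3 t4 : ℂ) : ℂ :=
  t1 ^ (-(n : ℤ)) * qpoch (t1 * t2) q n * qpoch (t1 * t3) q n * qpoch (t1 * t4) q n *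
    ∑ k ∈ Finset.range (n + 1),
      (qpoch (q ^ (-(n : ℤ))) q k * qpoch (t1 * t2 * t3 * t4 * q ^ ((n : ℤ) - 1)) q k *
        qpoch (t1 * u) q k * qpoch (t1 / u) q k * q ^ k) /
      (qpoch q q k * qpoch (t1 * t2) q k * qpoch (t1 * t3) q k * qpoch (t1 * t4) q k)

theorem qpoch_zero (a q : ℂ) : qpoch a q 0 = 1 := by simp [qpoch]

theorem qpoch_succ (a q : ℂ) (k : ℕ) : qpoch a q (k + 1) = qpoch a q k * (1 - a * q ^ k) := by
  simp [qpoch, prod_range_succ]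

theorem qpoch_succ' (a q : ℂ) (k : ℕ) : qpoch a q (k + 1) = (1 - a) * qpoch (a * q) q k := by
  simp only [qpoch, prod_range_succ', pow_zero, mul_one]
  rw [mul_comm]
  congr 1
  exact prod_congr rfl fun i _ => by ring

theorem qpoch_add (a q : ℂ) (m k : ℕ) :
    qpoch a q (m + k) = qpoch a q m * ∏ j ∈ range k, (1 - a * q ^ (m + j)) := by
  simp [qpoch, prod_range_add]

theorem qpoch_ne_zero_of_le {a q : ℂ} {k n : ℕ} (h : qpoch a q n ≠ 0) (hk : k ≤ n) :
    qpoch a q k ≠ 0 := by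
  obtain ⟨m, rfl⟩ := Nat.exists_eq_add_of_le hk
  rw [qpoch_add] at h
  exact left_ne_zero_of_mul h

/-- Reversal of the last `k` factors of a `q`-shifted factorial. -/
theorem qpoch_add_eq_reverse {q y : ℂ} (hq : q ≠ 0) (hy : y ≠ 0) (m k : ℕ) :
    qpoch y q (m + k) = qpoch y q m * qpoch (q ^ (1 - ((m + k : ℕ) : ℤ)) / y) q k *
      ((-y) ^ k * ∏ j ∈ range k, q ^ (m + j)) := by
  have hrev : qpoch (q ^ (1 - ((m + k : ℕ) : ℤ)) / y) q k =
      ∏ j ∈ range k, (1 - (q ^ (m + j))⁻¹ / y) := by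
    rw [qpoch, ← prod_range_reflect]
    refine prod_congr rfl fun j hj => ?_
    have hj := mem_range.mp hj
    have : q ^ (1 - ((m + k : ℕ) : ℤ)) * q ^ (k - 1 - j) = (q ^ (m + j))⁻¹ := by
      rw [← zpow_natCast, ← zpow_natCast, ← zpow_neg, ← zpow_add₀ hq]
      congr 1
      omega
    rw [← this]
    ring
  have hpow : (-y) ^ k = ∏ _j ∈ range k, (-y) := by simp
  rw [qpoch_add, hrev, hpow, mul_assoc, ← prod_mul_distrib, ← prod_mul_distrib]
  congr 1
  refine prod_congr rfl fun j _ => ?_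
  have := pow_ne_zero (m + j) hq
  field_simp
  ring

/-- The summand of the terminating `q`-Pfaff–Saalschütz sum, in denominator-free normalization
with respect to the parameters. -/
noncomputable def saalschutzTerm (q a b x : ℂ) (k m : ℕ) : ℂ :=
  qpoch a q k * qpoch b q k * x ^ k * qpoch x q m * qpoch (a * b * x * q ^ k) q m /
    (qpoch q q k * qpoch q q m)

theorem saalschutzTerm_zero_succ (q a b x : ℂ) (m : ℕ) (h : qpoch q q (m + 1) ≠ 0) :
    (1 - q ^ (m + 1)) * saalschutzTerm q a b x 0 (m + 1) =
      (1 - x * q ^ m) * (1 - a * b * x * q ^ m) * saalschutzTerm q a b x 0 m := by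
  rw [qpoch_succ] at h
  have h1 := left_ne_zero_of_mul h
  have h2 := right_ne_zero_of_mul h
  simp only [saalschutzTerm, qpoch_succ, qpoch_zero, pow_succ', pow_zero, mul_one]
  generalize q ^ m = y at *
  field_simp

theorem saalschutzTerm_succ_zero (q a b x : ℂ) (k : ℕ) (h : qpoch q q (k + 1) ≠ 0) :
    (1 - q ^ (k + 1)) * saalschutzTerm q a b x (k + 1) 0 =
      x * (1 - a * q ^ k) * (1 - b * q ^ k) * saalschutzTerm q a b x k 0 := by
  rw [qpoch_succ] at h
  have h1 := left_ne_zero_of_mul h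
  have h2 := right_ne_zero_of_mul h
  simp only [saalschutzTerm, qpoch_succ, qpoch_zero, pow_succ', mul_one]
  generalize q ^ k = y at *
  field_simp

theorem saalschutzTerm_succ_succ (q a b x : ℂ) (k m : ℕ) (hk : qpoch q q (k + 1) ≠ 0)
    (hm : qpoch q q (m + 1) ≠ 0) :
    (1 - q ^ (k + m + 2)) * saalschutzTerm q a b x (k + 1) (m + 1) =
      (1 - x * q ^ m) * (1 - a * b * x * q ^ (2 * k + m + 2)) * saalschutzTerm q a b x (k + 1) m +
      x * q ^ (m + 1) * (1 - a * q ^ k) * (1 - b * q ^ k) * saalschutzTerm q a b x k (m + 1) := by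
  have hc : qpoch (a * b * x * q ^ k) q (m + 1) =
      (1 - a * b * x * q ^ k) * qpoch (a * b * x * q ^ (k + 1)) q m := by
    rw [qpoch_succ', pow_succ, ← mul_assoc]
  rw [qpoch_succ] at hk hm
  have hk1 := left_ne_zero_of_mul hk
  have hk2 := right_ne_zero_of_mul hk
  have hm1 := left_ne_zero_of_mul hm
  have hm2 := right_ne_zero_of_mul hm
  have h1 : q ^ (k + m + 2) = q ^ k * q ^ m * q ^ 2 := by ring
  have h2 : q ^ (2 * k + m + 2) = (q ^ k) ^ 2 * q ^ m * q ^ 2 := by ring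
  simp only [saalschutzTerm, hc, h1, h2]
  simp only [qpoch_succ]
  generalize qpoch (a * b * x * q ^ (k + 1)) q m = C at *
  simp only [pow_succ q k, pow_succ q m]
  clear hc h1 h2 hk hm
  rw [mul_comm q] at hk2 hm2
  generalize q ^ k = K at *
  generalize q ^ m = M at *
  field_simp
  ring

/-- The terminating `q`-Pfaff–Saalschütz summation formula. -/
theorem sum_antidiagonal_saalschutzTerm (q a b x : ℂ) (n : ℕ) (h : qpoch q q n ≠ 0) :
    ∑ p ∈ antidiagonal n, saalschutzTerm q a b x p.1 p.2 =
      qpoch (a * x) q n * qpoch (b * x) q n / qpoch q q n := by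
  induction n with
  | zero => simp [saalschutzTerm, qpoch_zero]
  | succ n ih =>
    have hle : ∀ {j}, j ≤ n + 1 → qpoch q q j ≠ 0 := fun hj => qpoch_ne_zero_of_le h hj
    have hn : qpoch q q n ≠ 0 := hle n.le_succ
    have hq : 1 - q ^ (n + 1) ≠ 0 := by
      rw [qpoch_succ] at h
      simpa [pow_succ'] using right_ne_zero_of_mul h
    let A : ℕ → ℕ → ℂ := fun k m =>
      (1 - x * q ^ m) * (1 - a * b * x * q ^ (2 * k + m)) * saalschutzTerm q a b x k m
    let B : ℕ → ℕ → ℂ := fun k m =>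
      x * q ^ m * (1 - a * q ^ k) * (1 - b * q ^ k) * saalschutzTerm q a b x k m
    let A' : ℕ → ℕ → ℂ := fun k m => Nat.casesOn m 0 (A k)
    let B' : ℕ → ℕ → ℂ := fun k m => Nat.casesOn k 0 (fun k => B k m)
    have hA : ∑ p ∈ antidiagonal (n + 1), A' p.1 p.2 = ∑ p ∈ antidiagonal n, A p.1 p.2 := by
      rw [Nat.sum_antidiagonal_succ']
      simp [A']
    have hB : ∑ p ∈ antidiagonal (n + 1), B' p.1 p.2 = ∑ p ∈ antidiagonal n, B p.1 p.2 := by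
      rw [Nat.sum_antidiagonal_succ]
      simp [B']
    have hsplit : ∀ p ∈ antidiagonal (n + 1),
        (1 - q ^ (n + 1)) * saalschutzTerm q a b x p.1 p.2 = A' p.1 p.2 + B' p.1 p.2 := by
      rintro ⟨k, m⟩ hp
      have hp : k + m = n + 1 := mem_antidiagonal.mp hp
      rw [← hp]
      rcases k with _ | k <;> rcases m with _ | m
      · omega
      · simpa [A', B', A] using saalschutzTerm_zero_succ q a b x m (hle (by omega))
      · simpa [A', B', B] using saalschutzTerm_succ_zero q a b x k (hle (by omega))
      · have := saalschutzTerm_succ_succ q a b x k m (hle (by omega)) (hle (by omega))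
        simp only [A', B', A, B]
        convert this using 3 <;> ring
    have hmerge : ∀ p ∈ antidiagonal n, A p.1 p.2 + B p.1 p.2 =
        (1 - a * x * q ^ n) * (1 - b * x * q ^ n) * saalschutzTerm q a b x p.1 p.2 := by
      rintro ⟨k, m⟩ hp
      have hp : k + m = n := mem_antidiagonal.mp hp
      subst hp
      simp only [A, B]
      ring
    have key : (1 - q ^ (n + 1)) * ∑ p ∈ antidiagonal (n + 1), saalschutzTerm q a b x p.1 p.2 =
        (1 - a * x * q ^ n) * (1 - b * x * q ^ n) *
          ∑ p ∈ antidiagonal n, saalschutzTerm q a b x p.1 p.2 := by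
      rw [mul_sum, sum_congr rfl hsplit, sum_add_distrib, hA, hB, ← sum_add_distrib,
        sum_congr rfl hmerge, mul_sum]
    rw [ih hn] at key
    refine mul_left_cancel₀ hq (key.trans ?_)
    rw [qpoch_succ, qpoch_succ, qpoch_succ q, ← pow_succ']
    field_simp

/-- The terminating `q`-Pfaff–Saalschütz summation formula as a balanced basic hypergeometric
sum. -/
theorem sum_qSaalschutz {q a b x : ℂ} (n : ℕ) (hq : q ≠ 0) (hx : x ≠ 0)
    (hqq : qpoch q q n ≠ 0) (hxn : qpoch x q n ≠ 0) (hc : qpoch (a * b * x) q n ≠ 0) :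
    ∑ k ∈ range (n + 1), qpoch (q ^ (-(n : ℤ))) q k * qpoch a q k * qpoch b q k * q ^ k /
        (qpoch q q k * qpoch (a * b * x) q k * qpoch (q ^ (1 - (n : ℤ)) / x) q k) =
      qpoch (a * x) q n * qpoch (b * x) q n / (qpoch (a * b * x) q n * qpoch x q n) := by
  have hterm : ∀ p ∈ antidiagonal n,
      qpoch (q ^ (-(n : ℤ))) q p.1 * qpoch a q p.1 * qpoch b q p.1 * q ^ p.1 /
        (qpoch q q p.1 * qpoch (a * b * x) q p.1 * qpoch (q ^ (1 - (n : ℤ)) / x) q p.1) =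
      qpoch q q n / (qpoch (a * b * x) q n * qpoch x q n) *
        saalschutzTerm q a b x p.1 p.2 := by
    rintro ⟨k, m⟩ hp
    have hp : m + k = n := by rw [add_comm]; exact mem_antidiagonal.mp hp
    subst hp
    have hxr := qpoch_add_eq_reverse hq hx m k
    have hqr := qpoch_add_eq_reverse hq hq m k
    have hexp : q ^ (1 - ((m + k : ℕ) : ℤ)) / q = q ^ (-((m + k : ℕ) : ℤ)) := by
      rw [div_eq_mul_inv, ← zpow_sub_one₀ hq]
      congr 1
      ring
    rw [hexp] at hqr
    have hcr : qpoch (a * b * x) q (m + k) =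
        qpoch (a * b * x) q k * qpoch (a * b * x * q ^ k) q m := by
      rw [add_comm, qpoch_add]
      congr 1
      exact prod_congr rfl fun j _ => by ring
    have hqk := qpoch_ne_zero_of_le hqq (Nat.le_add_left k m)
    rw [hcr] at hc
    have hc1 := left_ne_zero_of_mul hc
    have hc2 := right_ne_zero_of_mul hc
    rw [hxr] at hxn
    rw [hqr] at hqq
    simp only [saalschutzTerm]
    rw [hcr, hxr, hqr]
    generalize qpoch (q ^ (1 - ((m + k : ℕ) : ℤ)) / x) q k = X at *
    generalize qpoch (q ^ (-((m + k : ℕ) : ℤ))) q k = Q at *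
    generalize ∏ j ∈ range k, q ^ (m + j) = P at *
    generalize qpoch (a * b * x * q ^ k) q m = C at *
    simp only [mul_ne_zero_iff] at hxn hqq
    obtain ⟨⟨hx1, hx2⟩, -, hP⟩ := hxn
    obtain ⟨⟨hq1, hq2⟩, -, -⟩ := hqq
    rw [neg_pow x, neg_pow q]
    have hneg : (-1 : ℂ) ^ k ≠ 0 := pow_ne_zero _ (by norm_num)
    field_simp
  rw [← Nat.sum_antidiagonal_eq_sum_range_succ_mk (fun p : ℕ × ℕ =>
      qpoch (q ^ (-(n : ℤ))) q p.1 * qpoch a q p.1 * qpoch b q p.1 * q ^ p.1 /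
        (qpoch q q p.1 * qpoch (a * b * x) q p.1 * qpoch (q ^ (1 - (n : ℤ)) / x) q p.1)),
    sum_congr rfl hterm, ← mul_sum, sum_antidiagonal_saalschutzTerm q a b x n hqq]
  field_simp

theorem askey_wilson_factorization_case1 (n : ℕ) (q t1 t2 t3 u : ℂ)
    (hq : q ≠ 0) (ht1 : t1 ≠ 0) (ht3 : t3 ≠ 0) (hu : u ≠ 0)
    (hqq : ∀ k : ℕ, k ≤ n → qpoch q q k ≠ 0)
    (h12 : ∀ k : ℕ, k ≤ n → qpoch (t1 * t2) q k ≠ 0)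
    (h13 : ∀ k : ℕ, k ≤ n → qpoch (t1 * t3) q k ≠ 0)
    (h14 : ∀ k : ℕ, k ≤ n → qpoch (q ^ (1 - (n : ℤ)) * t1 / t3) q k ≠ 0)
    (h31 : qpoch (t3 / t1) q n ≠ 0) :
    askeyWilson q n u t1 t2 t3 (q ^ (1 - (n : ℤ)) / t3)
      = qpoch (t3 * u) q n * qpoch (t3 / u) q n *
          (qpoch (t1 * t2) q n * qpoch (q ^ (1 - (n : ℤ)) * t1 / t3) q n) /
          (t1 ^ n * qpoch (t3 / t1) q n) := by
  have hx : t3 / t1 ≠ 0 := div_ne_zero ht3 ht1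
  have hc : t1 * u * (t1 / u) * (t3 / t1) = t1 * t3 := by field_simp
  have hd : q ^ (1 - (n : ℤ)) / (t3 / t1) = q ^ (1 - (n : ℤ)) * t1 / t3 := by field_simp
  have hd' : t1 * (q ^ (1 - (n : ℤ)) / t3) = q ^ (1 - (n : ℤ)) * t1 / t3 := by ring
  have ha : t1 * u * (t3 / t1) = t3 * u := by field_simp
  have hb : t1 / u * (t3 / t1) = t3 / u := by field_simp
  have hp : t1 * t2 * t3 * (q ^ (1 - (n : ℤ)) / t3) * q ^ ((n : ℤ) - 1) = t1 * t2 := by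
    have : q ^ (1 - (n : ℤ)) * q ^ ((n : ℤ) - 1) = 1 := by
      rw [← zpow_add₀ hq]
      simp
    calc _ = t1 * t2 * (t3 / t3) * (q ^ (1 - (n : ℤ)) * q ^ ((n : ℤ) - 1)) := by ring
      _ = _ := by rw [this, div_self ht3]; ring
  have hsum := sum_qSaalschutz (a := t1 * u) (b := t1 / u) n hq hx (hqq n le_rfl) h31
    (hc ▸ h13 n le_rfl)
  rw [hc, hd, ha, hb] at hsum
  have hcancel : ∀ k ∈ range (n + 1),
      qpoch (q ^ (-(n : ℤ))) q k * qpoch (t1 * t2) q k * qpoch (t1 * u) q k *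
          qpoch (t1 / u) q k * q ^ k /
        (qpoch q q k * qpoch (t1 * t2) q k * qpoch (t1 * t3) q k *
          qpoch (q ^ (1 - (n : ℤ)) * t1 / t3) q k) =
      qpoch (q ^ (-(n : ℤ))) q k * qpoch (t1 * u) q k * qpoch (t1 / u) q k * q ^ k /
        (qpoch q q k * qpoch (t1 * t3) q k * qpoch (q ^ (1 - (n : ℤ)) * t1 / t3) q k) := by
    intro k hk
    have hk := Nat.lt_succ_iff.mp (mem_range.mp hk)
    refine Eq.trans ?_ (mul_div_mul_left _ _ (h12 k hk))
    congr 1 <;> ring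
  rw [askeyWilson, hp, hd', sum_congr rfl hcancel, hsum, zpow_neg, zpow_natCast]
  have := h13 n le_rfl
  field_simp
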